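/- Let G be a finite group and P a set of prime numbers. For every cyclic P-perfect subgroup C ≤ G, the function e_C is a ℤ_(P)-linear combination of characters of finite-dimensional representations of G over the rational numbers ℚ (characters of ℚ-representations being viewed as functions G → ℂ via the inclusion ℚ ⊆ ℂ). In particular, every primitive idempotent of RU_P(G) lies in the subring of ℤ_(P)-linear combinations of characters of rational representations of G. -/

import Mathlib

open scoped Classical

/-- The subring `ℤ_(P) = ℤ[1/p : p ∉ P]` of `ℚ`, viewed inside `ℂ`. -/
noncomputable def ZPloc (P : Set ℕ) : Subring ℂ :=
  Subring.closure {z : ℂ | ∃ p : ℕ, p.Prime ∧ p ∉ P ∧ z = (p : ℂ)⁻¹}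

/-- `b` is the `P'`-part of `g`. -/
def IsPPrimePart {G : Type} [Group G] (P : Set ℕ) (g b : G) : Prop :=
  b ∈ Subgroup.zpowers g ∧
    (∀ p : ℕ, p.Prime → p ∣ orderOf b → p ∉ P) ∧
    (∀ p : ℕ, p.Prime → p ∣ orderOf (g * b⁻¹) → p ∈ P)

/-- Two subgroups of `G` are conjugate in `G`. -/
def SubConj {G : Type} [Group G] (C C' : Subgroup G) : Prop :=
  ∃ g : G, Subgroup.map (MulAut.conj g).toMonoidHom C = C'

/-- `C` is a cyclic subgroup whose order is not divisible by any prime in `P`. -/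
def CyclicPPerfect {G : Type} [Group G] (P : Set ℕ) (C : Subgroup G) : Prop :=
  IsCyclic C ∧ ∀ p : ℕ, p.Prime → p ∈ P → ¬ p ∣ Nat.card C

/-- The idempotent class function `e_C : G → ℂ`, equal to `1` at `g` iff `⟨g_{P'}⟩` is
conjugate in `G` to `C`, and `0` otherwise. -/
noncomputable def eIdem {G : Type} [Group G] (P : Set ℕ) (C : Subgroup G) : G → ℂ :=
  fun g => if ∃ b : G, IsPPrimePart P g b ∧ SubConj (Subgroup.zpowers b) C then 1 else 0

/-- `RU_P(G)`: the set of `ℤ_(P)`-linear combinations, inside the ring of functions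
`G → ℂ`, of characters of finite-dimensional complex representations of `G`. -/
noncomputable def RUP (G : Type) [Group G] [Fintype G] (P : Set ℕ) : Set (G → ℂ) :=
  {f | ∃ (n : ℕ) (c : Fin n → ℂ) (V : Fin n → FDRep ℂ G),
    (∀ i, c i ∈ ZPloc P) ∧ f = ∑ i, c i • (V i).character}

/-- `ℤ_(P)`-linear combinations of characters of finite-dimensional *rational*
representations of `G`, viewed as functions `G → ℂ` via `ℚ ⊆ ℂ`. -/
noncomputable def RQP (G : Type) [Group G] [Fintype G] (P : Set ℕ) : Set (G → ℂ) :=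
  {f | ∃ (n : ℕ) (c : Fin n → ℂ) (V : Fin n → FDRep ℚ G),
    (∀ i, c i ∈ ZPloc P) ∧ f = ∑ i, c i • fun g => ((V i).character g : ℂ)}

/-- `e` is a primitive idempotent of the (sub)ring with underlying set `S`. -/
def IsPrimitiveIdempotentIn {G : Type} (S : Set (G → ℂ)) (e : G → ℂ) : Prop :=
  e ∈ S ∧ e * e = e ∧ e ≠ 0 ∧
    ∀ e₁ e₂ : G → ℂ, e₁ ∈ S → e₂ ∈ S → e₁ * e₁ = e₁ → e₂ * e₂ = e₂ → e₁ * e₂ = 0 →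
      e = e₁ + e₂ → e₁ = 0 ∨ e₂ = 0

section PermutationCharacters

open Subgroup Pointwise

variable {G : Type} [Group G]

/-- The permutation character of `G ⧸ H`: the number of fixed points. -/
noncomputable def fixCount (H : Subgroup G) (g : G) : ℤ :=
  (MulAction.fixedBy (G ⧸ H) g).ncard

/-- The number of `x` conjugating `⟨g⟩` to `B`. -/
noncomputable def conjCount (B : Subgroup G) (g : G) : ℤ :=
  {x : G | zpowers (x⁻¹ * g * x) = B}.ncard

/-- The ring of integral combinations of permutation characters. -/
noncomputable def permRing (G : Type) [Group G] : Subring (G → ℤ) :=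
  Subring.closure (Set.range fixCount)

/-- `f` depends only on the conjugacy class of the cyclic subgroup generated by its argument. -/
def IsCyclicClassFun {α : Type} (f : G → α) : Prop :=
  ∀ g h x : G, zpowers (x⁻¹ * g * x) = zpowers h → f g = f h

lemma fixCount_mem_permRing (H : Subgroup G) : fixCount H ∈ permRing G :=
  Subring.subset_closure ⟨H, rfl⟩

lemma card_mul_fixCount (H : Subgroup G) (g : G) :
    (Nat.card H : ℤ) * fixCount H g = {x : G | x⁻¹ * g * x ∈ H}.ncard := by
  have h : {x : G | x⁻¹ * g * x ∈ H} =
      QuotientGroup.mk ⁻¹' (MulAction.fixedBy (G ⧸ H) g) := by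
    ext x
    simp only [Set.mem_ofPred_eq, Set.mem_preimage, MulAction.mem_fixedBy]
    rw [eq_comm, MulAction.Quotient.smul_mk, smul_eq_mul, QuotientGroup.eq, mul_assoc]
  rw [h, fixCount, ← Nat.card_coe_set_eq, ← Nat.card_coe_set_eq,
    Nat.card_congr (QuotientGroup.preimageMkEquivSubgroupProdSet H _), Nat.card_prod]
  push_cast
  rfl

lemma isCyclicClassFun_fixCount (H : Subgroup G) : IsCyclicClassFun (fixCount H) := by
  intro g h x hx
  have key : ∀ y : G, MulAction.fixedBy (G ⧸ H) y =
      {q | zpowers y ≤ MulAction.stabilizer G q} := by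
    intro y
    ext q
    simp [MulAction.mem_stabilizer_iff]
  have h1 : MulAction.fixedBy (G ⧸ H) h = x⁻¹ • MulAction.fixedBy (G ⧸ H) g := by
    rw [MulAction.smul_fixedBy, inv_inv, key, key, hx]
  rw [fixCount, fixCount, h1, ← Nat.card_coe_set_eq, ← Nat.card_coe_set_eq, Set.natCard_smul_set]

lemma fixCount_pow_prime [Finite G] (H : Subgroup G) (g : G) {p : ℕ} (hp : p.Prime) :
    (p : ℤ) ∣ fixCount H (g ^ p) ↔ (p : ℤ) ∣ fixCount H g := by
  have : Fact p.Prime := ⟨hp⟩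
  have : Fintype (G ⧸ H) := Fintype.ofFinite _
  have hfix : ∀ y : G, ((fixCount H y : ℤ) : ZMod p) =
      Matrix.trace ((MulAction.toPerm y : Equiv.Perm (G ⧸ H)).permMatrix (ZMod p)) := by
    intro y
    rw [Matrix.trace_permutation, fixCount]
    rw [Int.cast_natCast]
    rfl
  have hpow : ∀ (σ : Equiv.Perm (G ⧸ H)) (n : ℕ),
      (σ ^ n).permMatrix (ZMod p) = (σ.permMatrix (ZMod p)) ^ n := by
    intro σ n
    induction n with
    | zero => simp
    | succ n ih => rw [pow_succ, Matrix.permMatrix_mul, ih, pow_succ']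
  have h : ((fixCount H (g ^ p) : ℤ) : ZMod p) = (fixCount H g : ℤ) := by
    have hmap : (MulAction.toPerm (g ^ p) : Equiv.Perm (G ⧸ H)) = MulAction.toPerm g ^ p :=
      map_pow (MulAction.toPermHom G (G ⧸ H)) g p
    rw [hfix, hfix, hmap, hpow, ZMod.trace_pow_card, ZMod.pow_card]
  rw [← ZMod.intCast_zmod_eq_zero_iff_dvd, ← ZMod.intCast_zmod_eq_zero_iff_dvd, h]

lemma conjCount_mem_permRing [Finite G] (B : Subgroup G) : conjCount B ∈ permRing G := by
  have : Fintype G := Fintype.ofFinite _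
  have : Fintype (Subgroup G) := Fintype.ofFinite _
  induction hn : Nat.card B using Nat.strong_induction_on generalizing B with
  | _ n ih =>
  subst hn
  have hsum : (Nat.card B) • fixCount B =
      ∑ B' ∈ Finset.univ.filter (· ≤ B), conjCount B' := by
    funext g
    rw [Pi.smul_apply, nsmul_eq_mul, card_mul_fixCount, Finset.sum_apply]
    have hset : ∀ q : G → Prop, {x | q x}.ncard = (Finset.univ.filter q).card := by
      intro q
      rw [← Set.ncard_coe_finset]
      simp
    simp only [conjCount, hset]
    rw [Finset.card_eq_sum_card_fiberwise (f := fun x => zpowers (x⁻¹ * g * x))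
      (t := Finset.univ.filter (· ≤ B))]
    · push_cast
      refine Finset.sum_congr rfl fun B' hB' => ?_
      rw [Finset.filter_filter]
      congr 2
      ext x
      simp only [Finset.mem_filter, Finset.mem_univ, true_and] at hB' ⊢
      refine ⟨And.right, fun h => ⟨?_, h⟩⟩
      exact hB' (h ▸ mem_zpowers _)
    · intro x hx
      simpa using hx
  have hsplit : Finset.univ.filter (· ≤ B) = insert B (Finset.univ.filter (· < B)) := by
    ext B'
    simp [le_iff_eq_or_lt]
  rw [hsplit, Finset.sum_insert (by simp)] at hsum
  rw [eq_sub_of_add_eq hsum.symm]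
  refine sub_mem (nsmul_mem (fixCount_mem_permRing B) _) (sum_mem fun B' hB' => ?_)
  have hlt : B' < B := by simpa using hB'
  refine ih _ ?_ B' rfl
  exact Set.Finite.card_lt_card (Set.toFinite _) hlt

/-- Artin's induction theorem, for permutation characters. -/
lemma card_nsmul_mem_permRing [Finite G] {f : G → ℤ} (hf : IsCyclicClassFun f) :
    Nat.card G • f ∈ permRing G := by
  have : Fintype G := Fintype.ofFinite _
  have : Fintype (Subgroup G) := Fintype.ofFinite _
  let F : Subgroup G → ℤ := fun B => if h : ∃ g, zpowers g = B then f h.choose else 0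
  have hF : ∀ g, F (zpowers g) = f g := by
    intro g
    have h : ∃ g', zpowers g' = zpowers g := ⟨g, rfl⟩
    simp only [F, dif_pos h]
    exact hf _ _ 1 (by simpa using h.choose_spec)
  have hsum : Nat.card G • f = ∑ B : Subgroup G, F B • conjCount B := by
    funext g
    have hconst : ∀ x, F (zpowers (x⁻¹ * g * x)) = f g := fun x => by
      rw [hF]; exact (hf g _ x rfl).symm
    rw [Pi.smul_apply, Finset.sum_apply]
    calc Nat.card G • f g = ∑ x : G, F (zpowers (x⁻¹ * g * x)) := by
          simp [hconst]
      _ = ∑ B : Subgroup G, ∑ x with zpowers (x⁻¹ * g * x) = B,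
            F (zpowers (x⁻¹ * g * x)) := by
          exact (Finset.sum_fiberwise _ _ _).symm
      _ = _ := by
          refine Finset.sum_congr rfl fun B _ => ?_
          rw [Finset.sum_congr rfl (g := fun _ => F B) (by intro x hx; simp at hx; rw [hx])]
          rw [Finset.sum_const, Pi.smul_apply, conjCount, ← Set.ncard_coe_finset]
          simp [mul_comm]
  rw [hsum]
  exact sum_mem fun B _ => zsmul_mem (conjCount_mem_permRing B) _

end PermutationCharacters

section Localization

open Subgroup

variable {G : Type} [Group G]

/-- The functions having a multiple by an integer prime to `p` in the ring of permutation
characters. -/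
def permRingLocal (G : Type) [Group G] {p : ℕ} (hp : p.Prime) : AddSubgroup (G → ℤ) where
  carrier := {f | ∃ n : ℕ, ¬ p ∣ n ∧ n • f ∈ permRing G}
  zero_mem' := ⟨1, hp.one_lt.ne' ∘ Nat.dvd_one.mp, by simp⟩
  add_mem' := by
    rintro f g ⟨n, hn, hf⟩ ⟨m, hm, hg⟩
    refine ⟨n * m, fun h => (hp.dvd_mul.mp h).elim hn hm, ?_⟩
    rw [smul_add, mul_comm, mul_smul, mul_comm, mul_smul]
    exact add_mem (nsmul_mem hf _) (nsmul_mem hg _)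
  neg_mem' := by
    rintro f ⟨n, hn, hf⟩
    exact ⟨n, hn, by rw [smul_neg]; exact neg_mem hf⟩

lemma mem_of_pow_prime_pow_mem {D : Subgroup G} {g : G} {p k : ℕ} (hp : p.Prime)
    (hg : ¬ p ∣ orderOf g) (h : g ^ p ^ k ∈ D) : g ∈ D := by
  obtain ⟨m, hm⟩ := exists_pow_eq_self_of_coprime
    (Nat.Coprime.pow_left k ((hp.coprime_iff_not_dvd).mpr hg))
  rw [← hm]
  exact pow_mem h m

/-- A Sylow `p`-subgroup of the normalizer of `D` modulo `D`, pulled back to `G`. -/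
lemma exists_extension_by_sylow [Finite G] (D : Subgroup G) {p : ℕ} (hp : p.Prime) :
    ∃ H : Subgroup G, D ≤ H ∧ (∀ h ∈ H, ∃ k, h ^ p ^ k ∈ D) ∧
      ∃ m, ¬ p ∣ m ∧ Nat.card H * m = Nat.card (normalizer (D : Set G)) := by
  have : Fact p.Prime := ⟨hp⟩
  let N := normalizer (D : Set G)
  let K := D.subgroupOf N
  let S : Sylow p (N ⧸ K) := default
  refine ⟨((S : Subgroup (N ⧸ K)).comap (QuotientGroup.mk' K)).map N.subtype, ?_, ?_, ?_⟩
  · intro d hd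
    refine ⟨⟨d, le_normalizer hd⟩, ?_, rfl⟩
    have h1 : QuotientGroup.mk' K ⟨d, le_normalizer hd⟩ = 1 := by
      rw [QuotientGroup.mk'_apply, QuotientGroup.eq_one_iff]
      exact mem_subgroupOf.mpr hd
    simp only [SetLike.mem_coe, mem_comap, h1]
    exact one_mem _
  · rintro _ ⟨x, hx, rfl⟩
    obtain ⟨k, hk⟩ := S.isPGroup' ⟨_, hx⟩
    refine ⟨k, ?_⟩
    have h1 : QuotientGroup.mk' K (x ^ p ^ k) = 1 := by
      rw [map_pow]
      exact congrArg Subtype.val hk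
    rw [QuotientGroup.mk'_apply, QuotientGroup.eq_one_iff] at h1
    simpa using mem_subgroupOf.mp h1
  · refine ⟨(S : Subgroup (N ⧸ K)).index, Sylow.not_dvd_index S, ?_⟩
    rw [card_map_of_injective N.subtype_injective,
      ← index_comap_of_surjective _ (QuotientGroup.mk'_surjective K), card_mul_index]

lemma not_dvd_fixCount_of_zpowers_eq [Finite G] {D H : Subgroup G} {p m : ℕ} (hp : p.Prime)
    (hDH : D ≤ H) (hH : ∀ h ∈ H, ∃ k, h ^ p ^ k ∈ D) (hm : ¬ p ∣ m)
    (hcard : Nat.card H * m = Nat.card (normalizer (D : Set G)))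
    {d : G} (hd : ¬ p ∣ orderOf d) (hdD : zpowers d = D) : ¬ (p : ℤ) ∣ fixCount H d := by
  have hset : {x : G | x⁻¹ * d * x ∈ H} = (normalizer (D : Set G) : Set G) := by
    ext x
    rw [SetLike.mem_coe, ← inv_mem_iff, mem_normalizer_iff_map_conj_eq]
    have hmap : map (MulAut.conj x⁻¹ : G →* G) D = zpowers (x⁻¹ * d * x) := by
      rw [← hdD, MonoidHom.map_zpowers]
      simp
    have hord : orderOf (x⁻¹ * d * x) = orderOf d := by
      simpa using (MulAut.conj x⁻¹).orderOf_eq d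
    rw [hmap]
    constructor
    · intro hx
      obtain ⟨k, hk⟩ := hH _ hx
      have := mem_of_pow_prime_pow_mem hp (by rwa [hord]) hk
      refine eq_of_le_of_card_ge (zpowers_le.mpr this) ?_
      rw [Nat.card_zpowers, hord, ← hdD, Nat.card_zpowers]
    · intro h
      exact hDH (h ▸ mem_zpowers _)
  have h := card_mul_fixCount H d
  rw [hset, ← Nat.card_coe_set_eq] at h
  have h2 : (Nat.card H : ℤ) * fixCount H d = Nat.card H * (m : ℤ) := by
    rw [h]
    exact_mod_cast hcard.symm
  rw [mul_left_cancel₀ (by exact_mod_cast Nat.card_pos.ne') h2]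
  exact_mod_cast hm

/-- The indicator function of the locus where an integral combination of permutation characters
is not divisible by `p` is `p`-locally a combination of permutation characters. -/
lemma indicator_not_dvd_mem_permRingLocal [Finite G] {p : ℕ} (hp : p.Prime) {x : G → ℤ}
    (hx : x ∈ permRing G) (hcyc : IsCyclicClassFun x) :
    (fun g => if (p : ℤ) ∣ x g then 0 else 1) ∈ permRingLocal G hp := by
  set a := (Nat.card G).factorization p
  have hcard : p ^ a * (Nat.card G / p ^ a) = Nat.card G := Nat.ordProj_mul_ordCompl_eq_self _ _
  set n := Nat.card G / p ^ a
  set z : G → ℤ := fun g => if (p : ℤ) ∣ x g then 0 else 1 with hz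
  refine ⟨n, Nat.not_dvd_ordCompl hp Nat.card_pos.ne', ?_⟩
  set k := Nat.totient (p ^ a) * a with hk
  have hdvd : ∀ g, ((p ^ a : ℕ) : ℤ) ∣ (x ^ k) g - z g := by
    intro g
    have hak : a ≤ k := Nat.le_mul_of_pos_left _ (Nat.totient_pos.mpr (pow_pos hp.pos _))
    rw [Pi.pow_apply]
    by_cases h : (p : ℤ) ∣ x g
    · simp only [hz, h, if_true, sub_zero]
      push_cast
      exact (pow_dvd_pow _ hak).trans (pow_dvd_pow_of_dvd h k)
    · simp only [hz, h, if_false]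
      have hu : IsUnit ((x g : ℤ) : ZMod (p ^ a)) := by
        rw [ZMod.coe_int_isUnit_iff_isCoprime]
        push_cast
        exact IsCoprime.pow_left ((Nat.prime_iff_prime_int.mp hp).coprime_iff_not_dvd.mpr h)
      obtain ⟨u, hu⟩ := hu
      have : NeZero (p ^ a) := ⟨(pow_pos hp.pos a).ne'⟩
      rw [← ZMod.intCast_zmod_eq_zero_iff_dvd]
      push_cast
      rw [← hu, hk, pow_mul, ← Units.val_pow_eq_pow_val, ZMod.pow_totient]
      simp
  choose w hw using hdvd
  have hp0 : ((p ^ a : ℕ) : ℤ) ≠ 0 := by exact_mod_cast (pow_pos hp.pos a).ne'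
  have hwcyc : IsCyclicClassFun w := by
    intro g h y hy
    have hxy := hcyc g h y hy
    apply mul_left_cancel₀ hp0
    rw [← hw, ← hw, Pi.pow_apply, Pi.pow_apply, hxy]
    simp only [hz, hxy]
  have heq : n • z = n • x ^ k - Nat.card G • w := by
    funext g
    have := hw g
    rw [← hcard]
    simp only [Pi.sub_apply, nsmul_eq_mul, Pi.mul_apply, Pi.natCast_apply]
    push_cast at this ⊢
    linear_combination (-(n : ℤ)) * this
  rw [heq]
  exact sub_mem (nsmul_mem (pow_mem hx k) n) (card_nsmul_mem_permRing hwcyc)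

lemma apply_pow_pow_eq {α : Type} {f : G → α} {p : ℕ} (hf : ∀ g, f (g ^ p) = f g) (g : G)
    (k : ℕ) : f (g ^ p ^ k) = f g := by
  induction k with
  | zero => simp
  | succ k ih => rw [pow_succ, pow_mul, hf, ih]

lemma not_dvd_orderOf_pow [Finite G] {p : ℕ} (hp : p.Prime) (g : G) :
    ¬ p ∣ orderOf (g ^ p ^ (Nat.card G).factorization p) := by
  intro h
  refine Nat.not_dvd_ordCompl hp (Nat.card_pos (α := G)).ne' (h.trans (orderOf_dvd_of_pow_eq_one ?_))
  rw [← pow_mul, Nat.ordProj_mul_ordCompl_eq_self, pow_card_eq_one']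

lemma exists_separating_mem_permRingLocal [Finite G] {p : ℕ} (hp : p.Prime) {d : G}
    (hd : ¬ p ∣ orderOf d) :
    ∃ z ∈ permRingLocal G hp, IsCyclicClassFun z ∧ (∀ g, z (g ^ p) = z g) ∧ z d = 1 ∧
      ∀ g, z g ≠ 0 →
        ∃ x, x⁻¹ * g ^ p ^ (Nat.card G).factorization p * x ∈ zpowers d := by
  obtain ⟨H, hDH, hH, m, hm, hcard⟩ := exists_extension_by_sylow (zpowers d) hp
  have hpow : ∀ g, (if (p : ℤ) ∣ fixCount H (g ^ p) then (0 : ℤ) else 1) =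
      if (p : ℤ) ∣ fixCount H g then 0 else 1 := fun g => by simp only [fixCount_pow_prime H g hp]
  refine ⟨_, indicator_not_dvd_mem_permRingLocal hp (fixCount_mem_permRing H)
    (isCyclicClassFun_fixCount H), ?_, hpow, ?_, ?_⟩
  · intro g h x hx
    simp only [isCyclicClassFun_fixCount H g h x hx]
  · exact if_neg (not_dvd_fixCount_of_zpowers_eq hp hDH hH hm hcard hd rfl)
  · intro g hg
    set g' := g ^ p ^ (Nat.card G).factorization p with hg'
    have hg'ord : ¬ p ∣ orderOf g' := not_dvd_orderOf_pow hp g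
    rw [← apply_pow_pow_eq (f := fun g => if (p : ℤ) ∣ fixCount H g then (0 : ℤ) else 1) hpow g
      ((Nat.card G).factorization p), ← hg'] at hg
    have hne : fixCount H g' ≠ 0 := by
      intro h0
      simp [h0] at hg
    have hne' : {x : G | x⁻¹ * g' * x ∈ H}.ncard ≠ 0 := by
      intro h0
      have := card_mul_fixCount H g'
      rw [h0, Nat.cast_zero, mul_eq_zero] at this
      exact this.elim (by exact_mod_cast Nat.card_pos.ne') hne
    obtain ⟨x, hx⟩ := Set.nonempty_of_ncard_ne_zero hne'
    obtain ⟨k, hk⟩ := hH _ hx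
    refine ⟨x, mem_of_pow_prime_pow_mem hp ?_ hk⟩
    have hord : orderOf (x⁻¹ * g' * x) = orderOf g' := by
      simpa using (MulAut.conj x⁻¹).orderOf_eq g'
    rwa [hord]

lemma mem_permRingLocal_of_card_le [Finite G] {p : ℕ} (hp : p.Prime) (n m : ℕ) :
    ∀ f : G → ℤ, IsCyclicClassFun f → (∀ g, f (g ^ p) = f g) →
      (∀ g, f g ≠ 0 → orderOf (g ^ p ^ (Nat.card G).factorization p) ≤ n) →
      {g | f g ≠ 0 ∧ orderOf (g ^ p ^ (Nat.card G).factorization p) = n}.ncard ≤ m →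
      f ∈ permRingLocal G hp := by
  induction n generalizing m with
  | zero =>
    intro f _ _ hsupp _
    have : f = 0 := by
      funext g
      by_contra h
      exact (orderOf_pos _).ne' (Nat.le_zero.mp (hsupp g h))
    exact this ▸ zero_mem _
  | succ n ihn =>
    induction m with
    | zero =>
      intro f hcyc hpow hsupp hcard
      refine ihn _ f hcyc hpow (fun g hg => ?_) le_rfl
      refine Nat.le_of_lt_succ ((hsupp g hg).lt_of_ne fun h => ?_)
      have hempty := (Set.ncard_eq_zero (Set.toFinite _)).mp (Nat.le_zero.mp hcard)
      exact Set.notMem_empty g (hempty ▸ ⟨hg, h⟩)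
    | succ m ihm =>
      intro f hcyc hpow hsupp hcard
      by_cases hex : ∃ g, f g ≠ 0 ∧ orderOf (g ^ p ^ (Nat.card G).factorization p) = n + 1
      swap
      · refine ihm f hcyc hpow hsupp ?_
        push Not at hex
        have : {g | f g ≠ 0 ∧ orderOf (g ^ p ^ (Nat.card G).factorization p) = n + 1} = ∅ := by
          ext g
          simpa using hex g
        simp [this]
      obtain ⟨g₀, hg₀, hord₀⟩ := hex
      set a := (Nat.card G).factorization p
      obtain ⟨z, hz, hzcyc, hzpow, hz1, hzsupp⟩ :=
        exists_separating_mem_permRingLocal hp (not_dvd_orderOf_pow hp g₀)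
      have hordz : ∀ g, z g ≠ 0 → orderOf (g ^ p ^ a) ≤ n + 1 ∧
          (orderOf (g ^ p ^ a) = n + 1 → f g = f g₀) := by
        intro g hg
        obtain ⟨x, hx⟩ := hzsupp g hg
        have hconj : orderOf (x⁻¹ * g ^ p ^ a * x) = orderOf (g ^ p ^ a) := by
          simpa using (MulAut.conj x⁻¹).orderOf_eq (g ^ p ^ a)
        refine ⟨?_, fun h => ?_⟩
        · rw [← hconj, ← hord₀]
          exact Nat.le_of_dvd (orderOf_pos _) (orderOf_dvd_of_mem_zpowers hx)
        · rw [← apply_pow_pow_eq hpow g a, ← apply_pow_pow_eq hpow g₀ a]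
          refine hcyc _ _ x (eq_of_le_of_card_ge (zpowers_le.mpr hx) ?_)
          rw [Nat.card_zpowers, Nat.card_zpowers, hconj, h, hord₀]
      have hz0 : z g₀ = 1 := by rw [← apply_pow_pow_eq hzpow g₀ a, hz1]
      have hsub : f - f g₀ • z ∈ permRingLocal G hp := by
        refine ihm _ ?_ ?_ ?_ ?_
        · intro g h x hx
          simp [hcyc g h x hx, hzcyc g h x hx]
        · intro g
          simp [hpow g, hzpow g]
        · intro g hg
          by_cases hzg : z g = 0
          · exact hsupp g (by simpa [hzg] using hg)
          · exact (hordz g hzg).1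
        · refine Nat.le_of_lt_succ (lt_of_lt_of_le (Set.ncard_lt_ncard ?_ (Set.toFinite _)) hcard)
          refine (Set.ssubset_iff_of_subset ?_).mpr ⟨g₀, ⟨hg₀, hord₀⟩, by simp [hz0]⟩
          rintro g ⟨hg, hord⟩
          refine ⟨?_, hord⟩
          by_cases hzg : z g = 0
          · simpa [hzg] using hg
          · rw [(hordz g hzg).2 hord]
            exact hg₀
      have := add_mem hsub (zsmul_mem hz (f g₀))
      rwa [sub_add_cancel] at this

/-- A function on `G` constant on conjugacy classes of cyclic subgroups and invariant under the
`p`-th power maps for `p ∈ P` is, up to integers prime to `P`, a combination of permutation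
characters. -/
lemma exists_nsmul_mem_permRing [Finite G] {P : Set ℕ} (hP : ∀ p ∈ P, Nat.Prime p) {f : G → ℤ}
    (hcyc : IsCyclicClassFun f) (hpow : ∀ p ∈ P, ∀ g, f (g ^ p) = f g) :
    ∃ n : ℕ, n ≠ 0 ∧ (∀ p ∈ P, ¬ p ∣ n) ∧ n • f ∈ permRing G := by
  let I : Ideal ℤ := Submodule.comap (LinearMap.toSpanSingleton ℤ (G → ℤ) f)
    (AddSubgroup.toIntSubmodule (permRing G).toAddSubgroup)
  have hI : ∀ n : ℤ, n ∈ I ↔ n • f ∈ permRing G := fun n => Iff.rfl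
  obtain ⟨d, hd⟩ := (IsPrincipalIdealRing.principal I).principal
  have hdvd : ∀ n : ℕ, n • f ∈ permRing G → d.natAbs ∣ n := by
    intro n hn
    rw [← natCast_zsmul, ← hI, hd] at hn
    exact Int.natAbs_dvd_natAbs.mpr (Ideal.mem_span_singleton.mp hn)
  refine ⟨d.natAbs, ?_, ?_, ?_⟩
  · intro h
    exact Nat.card_pos.ne' (Nat.eq_zero_of_zero_dvd (h ▸ hdvd _ (card_nsmul_mem_permRing hcyc)))
  · intro p hp hpd
    obtain ⟨n, hn, hnf⟩ := mem_permRingLocal_of_card_le (hP p hp) (Nat.card G) _ f hcyc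
      (hpow p hp) (fun g _ => orderOf_le_card) le_rfl
    exact hn (hpd.trans (hdvd n hnf))
  · rw [← natCast_zsmul, ← hI, hd, Ideal.submodule_span_eq, Ideal.mem_span_singleton]
    simp

end Localization

section RationalCharacters

open CategoryTheory MonoidalCategory

lemma inv_natCast_mem_ZPloc {P : Set ℕ} {n : ℕ} (hn : n ≠ 0) (hP : ∀ p ∈ P, ¬ p ∣ n) :
    ((n : ℂ)⁻¹) ∈ ZPloc P := by
  induction n using Nat.recOnMul with
  | zero => exact absurd rfl hn
  | one => simp
  | prime p hp => exact Subring.subset_closure ⟨p, hp, fun h => hP p h dvd_rfl, rfl⟩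
  | mul a b iha ihb =>
    rw [Nat.cast_mul, mul_inv]
    exact mul_mem
      (iha (left_ne_zero_of_mul hn) fun p hp h => hP p hp (h.mul_right b))
      (ihb (right_ne_zero_of_mul hn) fun p hp h => hP p hp (h.mul_left a))

lemma exists_natCast_mul_eq_intCast {P : Set ℕ} (hP : ∀ p ∈ P, Nat.Prime p) {c : ℂ}
    (hc : c ∈ ZPloc P) :
    ∃ n : ℕ, n ≠ 0 ∧ (∀ p ∈ P, ¬ p ∣ n) ∧ ∃ a : ℤ, (n : ℂ) * c = a := by
  have hone : ∀ p ∈ P, ¬ p ∣ 1 := fun p hp h => (hP p hp).one_lt.ne' (Nat.dvd_one.mp h)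
  induction hc using Subring.closure_induction with
  | mem x hx =>
    obtain ⟨q, hq, hqP, rfl⟩ := hx
    refine ⟨q, hq.ne_zero, fun p hp h => ?_, 1, ?_⟩
    · exact hqP ((Nat.prime_dvd_prime_iff_eq (hP p hp) hq).mp h ▸ hp)
    · rw [mul_inv_cancel₀ (by exact_mod_cast hq.ne_zero)]
      simp
  | zero => exact ⟨1, one_ne_zero, hone, 0, by simp⟩
  | one => exact ⟨1, one_ne_zero, hone, 1, by simp⟩
  | add x y _ _ hx hy =>
    obtain ⟨n, hn, hnP, a, ha⟩ := hx
    obtain ⟨m, hm, hmP, b, hb⟩ := hy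
    refine ⟨n * m, mul_ne_zero hn hm,
      fun p hp h => ((hP p hp).dvd_mul.mp h).elim (hnP p hp) (hmP p hp), m * a + n * b, ?_⟩
    push_cast
    rw [← ha, ← hb]
    ring
  | neg x _ hx =>
    obtain ⟨n, hn, hnP, a, ha⟩ := hx
    exact ⟨n, hn, hnP, -a, by push_cast; rw [← ha]; ring⟩
  | mul x y _ _ hx hy =>
    obtain ⟨n, hn, hnP, a, ha⟩ := hx
    obtain ⟨m, hm, hmP, b, hb⟩ := hy
    refine ⟨n * m, mul_ne_zero hn hm,
      fun p hp h => ((hP p hp).dvd_mul.mp h).elim (hnP p hp) (hmP p hp), a * b, ?_⟩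
    push_cast
    rw [← ha, ← hb]
    ring

variable {G : Type} [Group G]

/-- The permutation representation of `G` on the rational-valued functions on `G ⧸ H`. -/
noncomputable def permRep (H : Subgroup G) : Representation ℚ G (G ⧸ H → ℚ) where
  toFun g := LinearMap.funLeft ℚ ℚ (fun q => g⁻¹ • q)
  map_one' := by
    ext
    simp [LinearMap.funLeft]
  map_mul' g h := by
    refine LinearMap.ext fun f => funext fun q => ?_
    simp [LinearMap.funLeft_apply, mul_smul]

lemma trace_permRep [Finite G] (H : Subgroup G) (g : G) :
    LinearMap.trace ℚ _ (permRep H g) = fixCount H g := by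
  have : Fintype (G ⧸ H) := Fintype.ofFinite _
  have hmat : LinearMap.toMatrix' (permRep H g) =
      (MulAction.toPerm g⁻¹ : Equiv.Perm (G ⧸ H)).permMatrix ℚ := by
    ext i j
    rw [LinearMap.toMatrix'_apply]
    change (Pi.single j (1 : ℚ) : G ⧸ H → ℚ) (g⁻¹ • i) = _
    simp [Pi.single_apply, PEquiv.toMatrix_apply, Equiv.toPEquiv_apply, eq_comm]
  rw [LinearMap.trace_eq_matrix_trace ℚ (Pi.basisFun ℚ _), LinearMap.toMatrix_eq_toMatrix', hmat,
    Matrix.trace_permutation, fixCount, ← MulAction.fixedBy_inv, Int.cast_natCast]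
  rfl

variable [Fintype G]

lemma mem_RQP_iff_mem_span {P : Set ℕ} {f : G → ℂ} :
    f ∈ RQP G P ↔ f ∈ Submodule.span (ZPloc P)
      (Set.range fun (V : FDRep ℚ G) (g : G) => (V.character g : ℂ)) := by
  rw [Submodule.mem_span_set']
  constructor
  · rintro ⟨n, c, V, hc, rfl⟩
    exact ⟨n, fun i => ⟨c i, hc i⟩, fun i => ⟨_, V i, rfl⟩, rfl⟩
  · rintro ⟨n, c, v, rfl⟩
    choose V hV using fun i => (v i).2
    refine ⟨n, fun i => c i, V, fun i => (c i).2, ?_⟩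
    refine Finset.sum_congr rfl fun i _ => ?_
    rw [← hV i]
    rfl

lemma intCast_mem_span_of_mem_permRing (P : Set ℕ) {f : G → ℤ} (hf : f ∈ permRing G) :
    (fun g => (f g : ℂ)) ∈ Submodule.span (ZPloc P)
      (Set.range fun (V : FDRep ℚ G) (g : G) => (V.character g : ℂ)) := by
  induction hf using Subring.closure_induction with
  | mem x hx =>
    obtain ⟨H, rfl⟩ := hx
    refine Submodule.subset_span ⟨FDRep.of (permRep H), ?_⟩
    funext g
    have : (FDRep.of (permRep H)).character g = fixCount H g := trace_permRep H g
    simp [this]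
  | zero =>
    have h : (fun g : G => (((0 : G → ℤ) g : ℤ) : ℂ)) = 0 := by
      funext g
      simp
    exact h ▸ zero_mem _
  | one =>
    refine Submodule.subset_span ⟨FDRep.of (Representation.trivial ℚ G ℚ), ?_⟩
    funext g
    have : (FDRep.of (Representation.trivial ℚ G ℚ)).character g = 1 := by
      change LinearMap.trace ℚ ℚ LinearMap.id = 1
      simp
    simp [this]
  | add x y _ _ hx hy =>
    convert add_mem hx hy using 1
    funext g
    simp
  | neg x _ hx =>
    convert neg_mem hx using 1
    funext g
    simp
  | mul x y _ _ hx hy =>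
    have hmul := Submodule.mul_mem_mul hx hy
    rw [Submodule.span_mul_span] at hmul
    have heq : (fun g => (((x * y) g : ℤ) : ℂ)) = (fun g => (x g : ℂ)) * fun g => (y g : ℂ) := by
      funext g
      simp
    rw [heq]
    refine Submodule.span_mono ?_ hmul
    rintro _ ⟨_, ⟨V, rfl⟩, _, ⟨W, rfl⟩, rfl⟩
    refine ⟨V ⊗ W, ?_⟩
    funext g
    simp [FDRep.char_tensor]

/-- An integer-valued function constant on conjugacy classes of cyclic subgroups and invariant
under the `p`-th power maps for `p ∈ P` is a `ℤ_(P)`-combination of rational characters. -/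
lemma intCast_mem_RQP {P : Set ℕ} (hP : ∀ p ∈ P, Nat.Prime p) {f : G → ℤ}
    (hcyc : IsCyclicClassFun f) (hpow : ∀ p ∈ P, ∀ g, f (g ^ p) = f g) :
    (fun g => (f g : ℂ)) ∈ RQP G P := by
  obtain ⟨n, hn, hnP, hf⟩ := exists_nsmul_mem_permRing hP hcyc hpow
  rw [mem_RQP_iff_mem_span]
  have h := Submodule.smul_mem _ (⟨_, inv_natCast_mem_ZPloc hn hnP⟩ : ZPloc P)
    (intCast_mem_span_of_mem_permRing P hf)
  convert h using 1
  funext g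
  change _ = (n : ℂ)⁻¹ * (((n • f) g : ℤ) : ℂ)
  have : (n : ℂ) ≠ 0 := by exact_mod_cast hn
  simp [this]

end RationalCharacters

section PrimePart

open Subgroup

variable {G : Type} [Group G]

lemma SubConj.trans {A B C : Subgroup G} (h₁ : SubConj A B) (h₂ : SubConj B C) :
    SubConj A C := by
  obtain ⟨g, rfl⟩ := h₁
  obtain ⟨h, rfl⟩ := h₂
  refine ⟨h * g, ?_⟩
  rw [map_map]
  congr 1
  ext
  simp

lemma IsPPrimePart.conj {P : Set ℕ} {g b : G} (h : IsPPrimePart P g b) (x : G) :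
    IsPPrimePart P (x⁻¹ * g * x) (x⁻¹ * b * x) := by
  obtain ⟨hb, hP', hP⟩ := h
  have key : ∀ y, x⁻¹ * y * x = MulAut.conj x⁻¹ y := fun y => by simp
  simp only [key]
  refine ⟨?_, ?_, ?_⟩
  · obtain ⟨k, rfl⟩ := hb
    exact ⟨k, (map_zpow _ _ _).symm⟩
  · rwa [MulEquiv.orderOf_eq]
  · rwa [← map_inv, ← map_mul, MulEquiv.orderOf_eq]

lemma IsPPrimePart.exists_of_zpowers_eq {P : Set ℕ} {g h b : G} (hb : IsPPrimePart P g b)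
    (hgh : zpowers g = zpowers h) : ∃ c, IsPPrimePart P h c ∧ zpowers c = zpowers b := by
  obtain ⟨⟨j, rfl⟩, hP', hP⟩ := hb
  obtain ⟨k, hk⟩ : h ∈ zpowers g := hgh ▸ mem_zpowers h
  obtain ⟨l, hl⟩ : g ∈ zpowers h := hgh ▸ mem_zpowers g
  simp only at hk hl hP hP'
  have hz : zpowers (h ^ j) = zpowers (g ^ j) := by
    refine le_antisymm (zpowers_le.mpr ⟨k, ?_⟩) (zpowers_le.mpr ⟨l, ?_⟩)
    · simp only
      rw [← hk, ← zpow_mul, ← zpow_mul, mul_comm]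
    · simp only
      conv_rhs => rw [← hl]
      rw [← zpow_mul, ← zpow_mul, mul_comm]
  refine ⟨h ^ j, ⟨⟨j, rfl⟩, ?_, ?_⟩, hz⟩
  · rwa [← Nat.card_zpowers, hz, Nat.card_zpowers]
  · intro p hp hdvd
    refine hP p hp (hdvd.trans (orderOf_dvd_of_mem_zpowers ⟨k, ?_⟩))
    simp only
    rw [← hk, ((Commute.refl g).zpow_right j).inv_right.mul_zpow, ← zpow_mul, inv_zpow,
      ← zpow_mul, mul_comm j k]

lemma IsPPrimePart.pow_prime [Finite G] {P : Set ℕ} {g b : G} (h : IsPPrimePart P g b) {p : ℕ}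
    (hp : p.Prime) (hpP : p ∈ P) :
    ∃ c, IsPPrimePart P (g ^ p) c ∧ zpowers c = zpowers b := by
  obtain ⟨⟨j, rfl⟩, hP', hP⟩ := h
  simp only at hP hP'
  have hcop : Nat.Coprime p (orderOf (g ^ j)) :=
    hp.coprime_iff_not_dvd.mpr fun h => hP' p hp h hpP
  have hz : zpowers ((g ^ p) ^ j) = zpowers (g ^ j) := by
    have hcomm : (g ^ p) ^ j = (g ^ j) ^ p := by
      rw [← zpow_natCast, ← zpow_natCast, ← zpow_mul, ← zpow_mul, mul_comm]
    rw [hcomm]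
    obtain ⟨m, hm⟩ := exists_pow_eq_self_of_coprime hcop
    refine le_antisymm (zpowers_le.mpr (pow_mem (mem_zpowers (g ^ j)) p)) (zpowers_le.mpr ?_)
    have := pow_mem (mem_zpowers ((g ^ j) ^ p)) m
    rwa [hm] at this
  refine ⟨(g ^ p) ^ j, ⟨⟨j, rfl⟩, ?_, ?_⟩, hz⟩
  · rwa [← Nat.card_zpowers, hz, Nat.card_zpowers]
  · intro q hq hdvd
    refine hP q hq (hdvd.trans (orderOf_dvd_of_mem_zpowers ⟨(p : ℤ), ?_⟩))
    simp only
    rw [((Commute.refl g).zpow_right j).inv_right.mul_zpow, inv_zpow,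
      ← zpow_natCast g p, ← zpow_mul, ← zpow_mul, mul_comm j]

lemma IsPPrimePart.of_pow_prime [Finite G] {P : Set ℕ} {g b : G} {p : ℕ}
    (h : IsPPrimePart P (g ^ p) b) (hp : p.Prime) (hpP : p ∈ P) :
    ∃ c, IsPPrimePart P g c ∧ zpowers c = zpowers b := by
  obtain ⟨hb, hP', hP⟩ := h
  have hcop : Nat.Coprime p (orderOf b) :=
    hp.coprime_iff_not_dvd.mpr fun h => hP' p hp h hpP
  obtain ⟨m, hm⟩ := exists_pow_eq_self_of_coprime hcop
  have hz : zpowers (b ^ m) = zpowers b := by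
    refine le_antisymm (zpowers_le.mpr (pow_mem (mem_zpowers b) m)) (zpowers_le.mpr ?_)
    have := pow_mem (mem_zpowers (b ^ m)) p
    rwa [pow_right_comm, hm] at this
  have hbg : b ^ m ∈ zpowers g :=
    pow_mem ((zpowers_le.mpr (pow_mem (mem_zpowers g) p) : zpowers (g ^ p) ≤ zpowers g) hb) m
  refine ⟨b ^ m, ⟨hbg, ?_, ?_⟩, hz⟩
  · rwa [← Nat.card_zpowers, hz, Nat.card_zpowers]
  · intro q hq hdvd
    have hcomm : Commute g (b ^ m)⁻¹ := by
      obtain ⟨i, hi⟩ := hbg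
      rw [← hi]
      exact ((Commute.refl g).zpow_right i).inv_right
    have hpow : (g * (b ^ m)⁻¹) ^ p = g ^ p * b⁻¹ := by
      rw [hcomm.mul_pow, inv_pow, pow_right_comm, hm]
    have hdvd' : orderOf (g * (b ^ m)⁻¹) ∣ p * orderOf (g ^ p * b⁻¹) := by
      rw [orderOf_dvd_iff_pow_eq_one, pow_mul, hpow, pow_orderOf_eq_one]
    rcases hq.dvd_mul.mp (hdvd.trans hdvd') with h | h
    · rwa [(Nat.prime_dvd_prime_iff_eq hq hp).mp h]
    · exact hP q hq h

lemma isCyclicClassFun_eIdem (P : Set ℕ) (C : Subgroup G) : IsCyclicClassFun (eIdem P C) := by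
  have key : ∀ g h x : G, zpowers (x⁻¹ * g * x) = zpowers h →
      (∃ b, IsPPrimePart P g b ∧ SubConj (zpowers b) C) →
      ∃ b, IsPPrimePart P h b ∧ SubConj (zpowers b) C := by
    rintro g h x hx ⟨b, hb, hbC⟩
    obtain ⟨c, hc, hcb⟩ := (hb.conj x).exists_of_zpowers_eq hx
    refine ⟨c, hc, SubConj.trans ⟨x, ?_⟩ hbC⟩
    rw [hcb, MonoidHom.map_zpowers]
    simp [mul_assoc]
  intro g h x hx
  have hx' : zpowers (x⁻¹⁻¹ * h * x⁻¹) = zpowers g := by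
    have := congrArg (map (MulAut.conj x).toMonoidHom) hx
    rw [MonoidHom.map_zpowers, MonoidHom.map_zpowers] at this
    rw [inv_inv]
    simpa [mul_assoc] using this.symm
  unfold eIdem
  rw [propext ⟨key g h x hx, key h g x⁻¹ hx'⟩]

lemma eIdem_pow_prime [Finite G] {P : Set ℕ} (C : Subgroup G) {p : ℕ} (hp : p.Prime)
    (hpP : p ∈ P) (g : G) : eIdem P C (g ^ p) = eIdem P C g := by
  unfold eIdem
  refine if_congr ⟨?_, ?_⟩ rfl rfl
  · rintro ⟨b, hb, hbC⟩
    obtain ⟨c, hc, hcb⟩ := hb.of_pow_prime hp hpP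
    exact ⟨c, hc, hcb ▸ hbC⟩
  · rintro ⟨b, hb, hbC⟩
    obtain ⟨c, hc, hcb⟩ := hb.pow_prime hp hpP
    exact ⟨c, hc, hcb ▸ hbC⟩

end PrimePart

section ComplexCharacters

open Polynomial

lemma isIntegral_int_of_pow_eq_one {n : ℕ} (hn : n ≠ 0) {μ : ℂ} (h : μ ^ n = 1) :
    IsIntegral ℤ μ :=
  .of_pow (Nat.pos_of_ne_zero hn) (h ▸ isIntegral_one)

/-- The power traces of an endomorphism of finite order are the power sums of a family of
algebraic integers. -/
lemma exists_trace_pow_eq_sum {V : Type} [AddCommGroup V] [Module ℂ V] [FiniteDimensional ℂ V]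
    (f : Module.End ℂ V) {n : ℕ} (hn : n ≠ 0) (hf : f ^ n = 1) :
    ∃ (s : Finset ℂ) (m : ℂ → ℕ), (∀ μ ∈ s, IsIntegral ℤ μ) ∧
      ∀ k, LinearMap.trace ℂ V (f ^ k) = ∑ μ ∈ s, (m μ : ℂ) * μ ^ k := by
  have hsep : (X ^ n - 1 : ℂ[X]).Separable :=
    X_pow_sub_one_separable_iff.mpr (by exact_mod_cast hn)
  have hss : f.IsSemisimple := Module.End.isSemisimple_of_squarefree_aeval_eq_zero
    hsep.squarefree (by simp [hf])
  have hint := DirectSum.isInternal_submodule_of_iSupIndep_of_iSup_eq_top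
    f.eigenspaces_iSupIndep hss.iSup_eigenspace_eq_top
  have hfin : {μ | f.eigenspace μ ≠ ⊥}.Finite :=
    WellFoundedGT.finite_ne_bot_of_iSupIndep f.eigenspaces_iSupIndep
  have hpow : ∀ (k : ℕ) (μ : ℂ) (v : V), v ∈ f.eigenspace μ → (f ^ k) v = μ ^ k • v := by
    intro k μ v hv
    induction k with
    | zero => simp
    | succ k ih =>
      rw [pow_succ', Module.End.mul_apply, ih, map_smul, Module.End.mem_eigenspace_iff.mp hv,
        smul_smul, pow_succ]
  refine ⟨hfin.toFinset, fun μ => Module.finrank ℂ (f.eigenspace μ), ?_, ?_⟩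
  · intro μ hμ
    obtain ⟨v, hv, hv0⟩ := Submodule.exists_mem_ne_zero_of_ne_bot (hfin.mem_toFinset.mp hμ)
    refine isIntegral_int_of_pow_eq_one hn ?_
    have h := hpow n μ v hv
    rw [hf, Module.End.one_apply] at h
    have h' : (μ ^ n - 1) • v = 0 := by rw [sub_smul, ← h, one_smul, sub_self]
    exact sub_eq_zero.mp ((smul_eq_zero.mp h').resolve_right hv0)
  · intro k
    have hmaps : ∀ μ, Set.MapsTo (f ^ k) (f.eigenspace μ) (f.eigenspace μ) := by
      intro μ v hv
      rw [hpow k μ v hv]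
      exact Submodule.smul_mem _ _ hv
    rw [LinearMap.trace_eq_sum_trace_restrict' hint hfin hmaps]
    refine Finset.sum_congr rfl fun μ _ => ?_
    have hres : (f ^ k).restrict (hmaps μ) = μ ^ k • LinearMap.id := by
      refine LinearMap.ext fun v => Subtype.ext ?_
      exact hpow k μ v v.2
    rw [hres, map_smul, LinearMap.trace_id, smul_eq_mul, mul_comm]

/-- Modulo a prime number `q`, raising a character value to the power `q` amounts to raising the
group element to the power `q`. -/
lemma FDRep.exists_integral_character {G : Type} [Group G] [Finite G] (V : FDRep ℂ G) :
    ∃ χ : G → integralClosure ℤ ℂ, (∀ g, (χ g : ℂ) = V.character g) ∧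
      ∀ (q : ℕ) [Fact q.Prime] (R : Type) [CommRing R] [CharP R q]
        (φ : integralClosure ℤ ℂ →+* R) (g : G), φ (χ (g ^ q)) = φ (χ g) ^ q := by
  have key : ∀ g, ∃ (s : Finset ℂ) (m : ℂ → ℕ), (∀ μ ∈ s, IsIntegral ℤ μ) ∧
      ∀ k, V.character (g ^ k) = ∑ μ ∈ s, (m μ : ℂ) * μ ^ k := by
    intro g
    obtain ⟨s, m, hs, h⟩ := exists_trace_pow_eq_sum (V.ρ g) (Nat.card_pos (α := G)).ne'
      (by rw [← map_pow, pow_card_eq_one', map_one])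
    refine ⟨s, m, hs, fun k => ?_⟩
    rw [← h k, ← map_pow]
    rfl
  have hint : ∀ g, IsIntegral ℤ (V.character g) := by
    intro g
    obtain ⟨s, m, hs, h⟩ := key g
    rw [← pow_one g, h 1]
    refine IsIntegral.sum _ fun μ hμ => ?_
    exact (isIntegral_natCast _).mul ((hs μ hμ).pow 1)
  have hmem : ∀ g, V.character g ∈ integralClosure ℤ ℂ := hint
  refine ⟨fun g => ⟨V.character g, hmem g⟩, fun g => rfl, ?_⟩
  intro q _ R _ _ φ g
  obtain ⟨s, m, hs, h⟩ := key g
  have hsum : ∀ k, (⟨V.character (g ^ k), hmem _⟩ : integralClosure ℤ ℂ) =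
      ∑ μ : s, (m μ : integralClosure ℤ ℂ) * (⟨μ, hs μ μ.2⟩ : integralClosure ℤ ℂ) ^ k := by
    intro k
    apply Subtype.ext
    rw [AddSubmonoidClass.coe_finsetSum]
    simp only [h k]
    rw [← Finset.sum_coe_sort]
    refine Finset.sum_congr rfl fun μ _ => ?_
    simp
  have h1 := hsum 1
  simp only [pow_one] at h1
  change φ ⟨V.character (g ^ q), hmem _⟩ = φ ⟨V.character g, hmem _⟩ ^ q
  rw [hsum q, h1, map_sum, map_sum, ← frobenius_def, map_sum]
  refine Finset.sum_congr rfl fun μ _ => ?_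
  rw [map_mul, map_mul, map_mul, map_natCast, map_natCast, map_pow, frobenius_def]

lemma natCast_prime_mem_nonunits_integralClosure {q : ℕ} (hq : q.Prime) :
    (q : integralClosure ℤ ℂ) ∈ nonunits (integralClosure ℤ ℂ) := by
  intro hu
  obtain ⟨y, hy⟩ := hu.exists_right_inv
  have hy' : (q : ℂ) * (y : ℂ) = 1 := by simpa using congrArg Subtype.val hy
  have hq0 : (q : ℂ) ≠ 0 := by exact_mod_cast hq.ne_zero
  have hval : (y : ℂ) = algebraMap ℚ ℂ (q : ℚ)⁻¹ := by
    rw [eq_inv_of_mul_eq_one_right hy']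
    simp
  have hint : IsIntegral ℤ ((q : ℚ)⁻¹) := by
    rw [← isIntegral_algebraMap_iff (algebraMap ℚ ℂ).injective, ← hval]
    exact y.2
  obtain ⟨n, hn⟩ := IsIntegrallyClosed.isIntegral_iff.mp hint
  have hq0' : (q : ℚ) ≠ 0 := by exact_mod_cast hq.ne_zero
  have hn' : (q : ℤ) * n = 1 := by
    have : (q : ℚ) * (n : ℚ) = 1 := by
      have hn2 : (n : ℚ) = (q : ℚ)⁻¹ := hn
      rw [hn2, mul_inv_cancel₀ hq0']
    exact_mod_cast this
  exact hq.one_lt.ne' (Int.ofNat_inj.mp (Int.eq_one_of_mul_eq_one_right (by positivity) hn'))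

variable {G : Type} [Group G] [Fintype G]

lemma exists_common_denominator {P : Set ℕ} (hP : ∀ p ∈ P, Nat.Prime p) {N : ℕ} {c : Fin N → ℂ}
    (hc : ∀ i, c i ∈ ZPloc P) :
    ∃ n : ℕ, n ≠ 0 ∧ (∀ p ∈ P, ¬ p ∣ n) ∧ ∃ a : Fin N → ℤ, ∀ i, (n : ℂ) * c i = a i := by
  choose n hn hnP a ha using fun i => exists_natCast_mul_eq_intCast hP (hc i)
  refine ⟨∏ i, n i, Finset.prod_ne_zero_iff.mpr fun i _ => hn i, fun p hp h => ?_,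
    fun i => (∏ j ∈ Finset.univ.erase i, n j : ℕ) * a i, fun i => ?_⟩
  · obtain ⟨i, -, hi⟩ := (hP p hp).prime.exists_mem_finset_dvd h
    exact hnP i p hp hi
  · rw [← Finset.prod_erase_mul _ _ (Finset.mem_univ i)]
    push_cast
    rw [mul_assoc, ha]

/-- An idempotent of `RU_P(G)` is invariant under almost all prime power maps, including those
for primes in `P`. -/
lemma idempotent_pow_prime {P : Set ℕ} (hP : ∀ p ∈ P, Nat.Prime p) {f : G → ℂ}
    (hf : f ∈ RUP G P) (hidem : f * f = f) :
    ∃ n : ℕ, n ≠ 0 ∧ (∀ p ∈ P, ¬ p ∣ n) ∧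
      ∀ q, q.Prime → ¬ q ∣ n → ∀ g, f (g ^ q) = f g := by
  obtain ⟨N, c, V, hc, hfV⟩ := hf
  obtain ⟨n, hn, hnP, a, ha⟩ := exists_common_denominator hP hc
  refine ⟨n, hn, hnP, fun q hq hqn g => ?_⟩
  choose χ hχ hχq using fun i => (V i).exists_integral_character
  have : Fact q.Prime := ⟨hq⟩
  have := CharP.quotient (integralClosure ℤ ℂ) q
    (natCast_prime_mem_nonunits_integralClosure hq)
  set R := integralClosure ℤ ℂ ⧸ (Ideal.span {(q : integralClosure ℤ ℂ)})
  let φ : integralClosure ℤ ℂ →+* R := Ideal.Quotient.mk _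
  let F : G → integralClosure ℤ ℂ := fun g => ∑ i, (a i : integralClosure ℤ ℂ) * χ i g
  have hF : ∀ g, (F g : ℂ) = n * f g := by
    intro g
    simp only [F, hfV]
    rw [AddSubmonoidClass.coe_finsetSum, Finset.sum_apply, Finset.mul_sum]
    refine Finset.sum_congr rfl fun i _ => ?_
    rw [Pi.smul_apply, smul_eq_mul, ← mul_assoc, ha, ← hχ]
    simp
  have hFq : φ (F (g ^ q)) = φ (F g) ^ q := by
    simp only [F]
    rw [← frobenius_def, map_sum, map_sum, map_sum]
    refine Finset.sum_congr rfl fun i _ => ?_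
    rw [map_mul, map_mul, map_mul, map_intCast, map_intCast, hχq, frobenius_def]
  have h01 : ∀ g, f g = 0 ∨ f g = 1 := fun g =>
    (IsIdempotentElem.iff_eq_zero_or_one (p := f g)).mp (congrFun hidem g)
  have hnR : (n : R) ≠ 0 := fun h => hqn ((CharP.cast_eq_zero_iff R q n).mp h)
  have hF0 : ∀ g, f g = 0 → F g = 0 := fun g hg => by
    apply Subtype.ext
    rw [hF, hg]
    simp
  have hF1 : ∀ g, f g = 1 → F g = n := fun g hg => by
    apply Subtype.ext
    rw [hF, hg]
    simp
  have hfrob : (n : R) ^ q = n := by rw [← frobenius_def, map_natCast]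
  rcases h01 (g ^ q) with h | h <;> rcases h01 g with h' | h'
  · rw [h, h']
  · rw [hF0 _ h, hF1 _ h', map_zero, map_natCast, hfrob] at hFq
    exact absurd hFq.symm hnR
  · rw [hF1 _ h, hF0 _ h', map_zero, map_natCast, zero_pow hq.ne_zero] at hFq
    exact absurd hFq hnR
  · rw [h, h']

lemma isCyclicClassFun_of_pow_prime {α : Type} {f : G → α} {n : ℕ} (hn : n ≠ 0)
    (hconj : ∀ g x, f (x⁻¹ * g * x) = f g)
    (hpow : ∀ q, q.Prime → ¬ q ∣ n → ∀ g, f (g ^ q) = f g) : IsCyclicClassFun f := by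
  intro g h x hx
  rw [← hconj g x]
  set g' := x⁻¹ * g * x
  obtain ⟨k, rfl⟩ := mem_powers_iff_mem_zpowers.mpr (hx ▸ Subgroup.mem_zpowers h)
  simp only at hx ⊢
  have hcop : Nat.Coprime k (orderOf g') := by
    have h1 : orderOf (g' ^ k) = orderOf g' := by
      rw [← Nat.card_zpowers, ← hx, Nat.card_zpowers]
    rw [orderOf_pow, Nat.div_eq_self] at h1
    exact (Nat.coprime_comm.mp (h1.resolve_left (orderOf_pos g').ne'))
  obtain ⟨q, hqn, hq, hqk⟩ := Nat.forall_exists_prime_gt_and_modEq n (orderOf_pos g').ne' hcop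
  rw [← pow_eq_pow_iff_modEq.mpr hqk,
    hpow q hq fun h => hqn.not_ge (Nat.le_of_dvd (Nat.pos_of_ne_zero hn) h)]

lemma mem_RQP_of_zero_or_one {P : Set ℕ} (hP : ∀ p ∈ P, Nat.Prime p) {f : G → ℂ}
    (h01 : ∀ g, f g = 0 ∨ f g = 1) (hcyc : IsCyclicClassFun f)
    (hpow : ∀ p ∈ P, ∀ g, f (g ^ p) = f g) : f ∈ RQP G P := by
  have h : f = fun g => ((if f g = 1 then 1 else 0 : ℤ) : ℂ) := by
    funext g
    rcases h01 g with h | h <;> simp [h]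
  rw [h]
  refine intCast_mem_RQP hP ?_ ?_
  · intro g g' x hx
    simp only [hcyc g g' x hx]
  · intro p hp g
    simp only [hpow p hp g]

lemma idempotent_mem_RQP {P : Set ℕ} (hP : ∀ p ∈ P, Nat.Prime p) {f : G → ℂ}
    (hf : f ∈ RUP G P) (hidem : f * f = f) : f ∈ RQP G P := by
  obtain ⟨n, hn, hnP, hpow⟩ := idempotent_pow_prime hP hf hidem
  refine mem_RQP_of_zero_or_one hP
    (fun g => (IsIdempotentElem.iff_eq_zero_or_one (p := f g)).mp (congrFun hidem g))
    (isCyclicClassFun_of_pow_prime hn (fun g x => ?_) hpow)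
    (fun p hp => hpow p (hP p hp) (hnP p hp))
  obtain ⟨N, c, V, hc, rfl⟩ := hf
  have hconj : ∀ i, (V i).character (x⁻¹ * g * x) = (V i).character g := fun i => by
    simpa using (V i).char_conj g x⁻¹
  simp [Finset.sum_apply, hconj]

end ComplexCharacters

/-- each `e_C` is a `ℤ_(P)`-linear combination of characters of rational
representations of `G`; in particular every primitive idempotent of `RU_P(G)` lies in the
subring of `ℤ_(P)`-linear combinations of characters of rational representations. -/
theorem eIdem_mem_rational_representation_ring (G : Type) [Group G] [Fintype G]
    (P : Set ℕ) (hP : ∀ p ∈ P, Nat.Prime p) :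
    (∀ C : Subgroup G, CyclicPPerfect P C → eIdem P C ∈ RQP G P) ∧
    (∀ f : G → ℂ, IsPrimitiveIdempotentIn (RUP G P) f → f ∈ RQP G P) := by
  refine ⟨fun C _ => mem_RQP_of_zero_or_one hP (fun g => ?_) (isCyclicClassFun_eIdem P C)
    fun p hp => eIdem_pow_prime C (hP p hp) hp, fun f hf => idempotent_mem_RQP hP hf.1 hf.2.1⟩
  unfold eIdem
  split_ifs
  · exact Or.inr rfl
  · exact Or.inl rfl
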